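/- arXiv:2405.10887 — 2 statements merged into one kernel-verified Lean document; each statement's English description precedes it below -/
import Mathlib

section
/- For every n ≥ 3, the graph D_n is planar: it admits a planar embedding. -/
/-- The ladder-with-hubs graph `G n`: vertices `v₁ = Sum.inl false`, `v₂ = Sum.inl true`,
`a i = Sum.inr (false, i)` and `b i = Sum.inr (true, i)` (`0`-based indices, so `a_1` of
the paper is `a 0`, etc.), with edges `(v₁, a i)`, `(v₂, b i)`, `(a i, b i)` for all `i`,
and `(a i, a (i+1))`, `(b i, b (i+1))`, `(a (i+1), b i)`. -/
def Gr (n : ℕ) : SimpleGraph (Bool ⊕ Bool × Fin n) :=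
  SimpleGraph.fromRel (fun u v =>
    match u, v with
    | Sum.inl c, Sum.inr (d, _) => c = d
    | Sum.inr (false, i), Sum.inr (true, j) => (i : ℕ) = (j : ℕ) ∨ (i : ℕ) = (j : ℕ) + 1
    | Sum.inr (false, i), Sum.inr (false, j) => (i : ℕ) + 1 = (j : ℕ)
    | Sum.inr (true, i), Sum.inr (true, j) => (i : ℕ) + 1 = (j : ℕ)
    | _, _ => False)

/-- The graph `D n`: the graph `G n` together with the wrap-around edges
`(a_1, a_n)`, `(b_1, b_n)` and `(a_1, b_n)` (in `0`-based indices: `(a 0, a (n-1))`,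
`(b 0, b (n-1))`, `(a 0, b (n-1))`). -/
def Dr (n : ℕ) : SimpleGraph (Bool ⊕ Bool × Fin n) :=
  SimpleGraph.fromRel (fun u v =>
    match u, v with
    | Sum.inl c, Sum.inr (d, _) => c = d
    | Sum.inr (false, i), Sum.inr (true, j) =>
        (i : ℕ) = (j : ℕ) ∨ (i : ℕ) = (j : ℕ) + 1 ∨ ((i : ℕ) = 0 ∧ (j : ℕ) = n - 1)
    | Sum.inr (false, i), Sum.inr (false, j) =>
        (i : ℕ) + 1 = (j : ℕ) ∨ ((i : ℕ) = 0 ∧ (j : ℕ) = n - 1)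
    | Sum.inr (true, i), Sum.inr (true, j) =>
        (i : ℕ) + 1 = (j : ℕ) ∨ ((i : ℕ) = 0 ∧ (j : ℕ) = n - 1)
    | _, _ => False)

/-- `G` has a `P`-minor: branch sets witnessing `P` as a minor of `G`. -/
def HasMinor {V W : Type} (G : SimpleGraph V) (P : SimpleGraph W) : Prop :=
  ∃ S : W → Set V, (∀ w, (S w).Nonempty) ∧ (∀ w, (G.induce (S w)).Connected) ∧
    (Pairwise fun w w' => Disjoint (S w) (S w')) ∧
    ∀ w w', P.Adj w w' → ∃ u ∈ S w, ∃ v ∈ S w', G.Adj u v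

/-- A graph is planar iff (by Wagner's theorem) it has no `K₅` minor and no `K_{3,3}`
minor. -/
def IsPlanar {V : Type} (G : SimpleGraph V) : Prop :=
  ¬ HasMinor G (⊤ : SimpleGraph (Fin 5)) ∧
    ¬ HasMinor G (completeBipartiteGraph (Fin 3) (Fin 3))

/-- The coboundary modulo two of a vertex function, as a function on unordered pairs. -/
def coboundary {V : Type} (p : V → ZMod 2) : Sym2 V → ZMod 2 :=
  Sym2.lift ⟨fun u v => p u + p v, fun _ _ => add_comm _ _⟩

@[simp] lemma coboundary_mk {V : Type} (p : V → ZMod 2) (u v : V) :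
    coboundary p s(u, v) = p u + p v := rfl

/-- A system of faces on a graph with trivial first cohomology modulo two: every edge lies on
exactly two faces, and an edge function sums to zero around every face exactly when it is a
coboundary. -/
structure IsSphericalFaces {V F : Type} [Fintype F] [DecidableEq V] (G : SimpleGraph V)
    (bd : F → Finset (Sym2 V)) : Prop where
  subset : ∀ f, ∀ x ∈ bd f, x ∈ G.edgeSet
  two_faces : ∀ x ∈ G.edgeSet, ∃ f g, f ≠ g ∧ ∀ k, x ∈ bd k ↔ k = f ∨ k = g
  sum_coboundary : ∀ p f, ∑ x ∈ bd f, coboundary p x = 0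
  exists_potential : ∀ h : Sym2 V → ZMod 2, (∀ f, ∑ x ∈ bd f, h x = 0) →
    ∃ p, ∀ x ∈ G.edgeSet, h x = coboundary p x

/-- Euler's inequality: a multigraph with edges `E`, vertices `W` and a dual system of faces `F`
has at least `|E| - |W| + 2` faces with nonzero boundary. -/
lemma euler_inequality {E W F : Type} [Fintype E] [Fintype W] [Nonempty W] [Fintype F]
    (s t : E → W) (z : F → E → ZMod 2)
    (hsum : ∀ e, ∑ f, z f e = 0)
    (hpot : ∀ h : E → ZMod 2, (∀ f, ∑ e, z f e * h e = 0) →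
      ∃ p : W → ZMod 2, ∀ e, h e = p (s e) + p (t e))
    (hE : Fintype.card W ≤ Fintype.card E) :
    Fintype.card E + 2 ≤ Fintype.card W + {f | z f ≠ 0}.ncard := by
  classical
  let cob : (W → ZMod 2) →ₗ[ZMod 2] (E → ZMod 2) :=
    LinearMap.pi fun e =>
      LinearMap.proj (R := ZMod 2) (φ := fun _ => ZMod 2) (s e) + LinearMap.proj (t e)
  have hcob : Module.finrank (ZMod 2) (LinearMap.range cob) + 1 ≤ Fintype.card W := by
    have h := LinearMap.finrank_range_add_finrank_ker cob
    rw [Module.finrank_fintype_fun_eq_card] at h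
    have h1 : 0 < Module.finrank (ZMod 2) (LinearMap.ker cob) := by
      have hmem : (fun _ => 1 : W → ZMod 2) ∈ LinearMap.ker cob := by
        rw [LinearMap.mem_ker]
        ext e
        change (1 : ZMod 2) + 1 = 0
        decide
      refine Module.finrank_pos_iff_exists_ne_zero.2 ⟨⟨_, hmem⟩, fun h0 => ?_⟩
      have := congrFun (congrArg Subtype.val h0) (Classical.arbitrary W)
      exact one_ne_zero this
    omega
  have hker : ∀ (T : Type) [Fintype T] (y : T → E → ZMod 2),
      (∀ h : E → ZMod 2, (∀ k, ∑ e, y k e * h e = 0) → ∀ f, ∑ e, z f e * h e = 0) →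
      Fintype.card E + 1 ≤ Fintype.card W + Fintype.card T := by
    intro T _ y hy
    let L : (E → ZMod 2) →ₗ[ZMod 2] (T → ZMod 2) := Matrix.toLin' (Matrix.of y)
    have hL : LinearMap.ker L ≤ LinearMap.range cob := by
      intro h hh
      rw [LinearMap.mem_ker] at hh
      obtain ⟨p, hp⟩ := hpot h (hy h fun k => congrFun hh k)
      exact ⟨p, funext fun e => (hp e).symm⟩
    have h1 := Submodule.finrank_mono hL
    have h2 := LinearMap.finrank_range_add_finrank_ker L
    rw [Module.finrank_fintype_fun_eq_card] at h2
    have h3 := Submodule.finrank_le (LinearMap.range L)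
    rw [Module.finrank_fintype_fun_eq_card] at h3
    omega
  by_cases hz : ∃ f₀, z f₀ ≠ 0
  · obtain ⟨f₀, hf₀⟩ := hz
    have hcard := hker {f // z f ≠ 0 ∧ f ≠ f₀} (fun k => z k.1) (by
      intro h hh
      have hne : ∀ f, f ≠ f₀ → ∑ e, z f e * h e = 0 := by
        intro f hf
        by_cases h0 : z f = 0
        · simp [h0]
        · exact hh ⟨f, h0, hf⟩
      intro f
      by_cases hf : f = f₀
      · subst hf
        have htot : ∑ g, ∑ e, z g e * h e = 0 := by
          rw [Finset.sum_comm]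
          simp [← Finset.sum_mul, hsum]
        rwa [Finset.sum_eq_single f (fun g _ hg => hne g hg) (by simp)] at htot
      · exact hne f hf)
    have hsplit : {f | z f ≠ 0}.ncard = Fintype.card {f // z f ≠ 0 ∧ f ≠ f₀} + 1 := by
      have : {f | z f ≠ 0} = insert f₀ {f | z f ≠ 0 ∧ f ≠ f₀} := by
        ext f
        by_cases hf : f = f₀ <;> simp [hf, hf₀]
      rw [this, Set.ncard_insert_of_notMem (by simp), ← Nat.card_coe_set_eq,
        Nat.card_eq_fintype_card]
      rfl
    omega
  · push Not at hz
    have := hker Empty (fun k => k.elim) (fun h _ f => by simp [hz])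
    simp at this
    omega

/-- If every edge is on at most two faces and every nonzero face boundary has at least `g` edges,
then the number of nonzero faces is bounded by double counting. -/
lemma girth_mul_faces_le {E F : Type} [Fintype E] [Fintype F] (z : F → E → ZMod 2) (g : ℕ)
    (htwo : ∀ e, {f | z f e ≠ 0}.ncard ≤ 2)
    (hg : ∀ f, z f ≠ 0 → g ≤ {e | z f e ≠ 0}.ncard) :
    {f | z f ≠ 0}.ncard * g ≤ Fintype.card E * 2 := by
  classical
  have h := Finset.sum_card_bipartiteAbove_eq_sum_card_bipartiteBelow
    (s := Finset.univ.filter fun f : F => z f ≠ 0) (t := (Finset.univ : Finset E))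
    (fun f e => z f e ≠ 0)
  have h1 : (Finset.univ.filter fun f : F => z f ≠ 0).card * g ≤
      ∑ f ∈ Finset.univ.filter fun f : F => z f ≠ 0,
        (Finset.univ.bipartiteAbove (fun f e => z f e ≠ 0) f).card := by
    rw [← smul_eq_mul]
    refine Finset.card_nsmul_le_sum _ _ _ fun f hf => ?_
    have := hg f (by simpa using hf)
    rwa [Set.ncard_eq_toFinset_card', Set.toFinset_ofPred] at this
  have h2 : ∑ e : E, ((Finset.univ.filter fun f : F => z f ≠ 0).bipartiteBelow
      (fun f e => z f e ≠ 0) e).card ≤ Fintype.card E * 2 := by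
    rw [← smul_eq_mul]
    refine Finset.sum_le_card_nsmul _ _ _ fun e _ => ?_
    have := htwo e
    rw [Set.ncard_eq_toFinset_card', Set.toFinset_ofPred] at this
    refine (Finset.card_le_card fun f hf => ?_).trans this
    simp only [Finset.mem_bipartiteBelow] at hf
    simpa using hf.2
  rw [Set.ncard_eq_toFinset_card', Set.toFinset_ofPred]
  omega

/-- A family of faces of a graph passes to every minor, by deleting and merging faces. -/
lemma IsSphericalFaces.exists_minor_faces {V W E F : Type} [Fintype V] [DecidableEq V] [Fintype E]
    [Fintype F] {G : SimpleGraph V} {bd : F → Finset (Sym2 V)} (hG : IsSphericalFaces G bd)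
    (S : W → Set V) (hne : ∀ w, (S w).Nonempty) (hconn : ∀ w, (G.induce (S w)).Connected)
    (hdisj : Pairwise fun w w' => Disjoint (S w) (S w')) (s t : E → W) (hst : ∀ e, s e ≠ t e)
    (hinj : Function.Injective fun e => s(s e, t e))
    (hadj : ∀ e, ∃ u ∈ S (s e), ∃ v ∈ S (t e), G.Adj u v) :
    ∃ (F' : Type) (_ : Fintype F') (z : F' → E → ZMod 2),
      (∀ e, ∑ c, z c e = 0) ∧ (∀ e, {c | z c e ≠ 0}.ncard ≤ 2) ∧
      (∀ (p : W → ZMod 2) c, ∑ e, z c e * (p (s e) + p (t e)) = 0) ∧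
      ∀ h : E → ZMod 2, (∀ c, ∑ e, z c e * h e = 0) →
        ∃ p : W → ZMod 2, ∀ e, h e = p (s e) + p (t e) := by
  classical
  choose u hu v hv huv using hadj
  have huniq : ∀ {w w' x}, x ∈ S w → x ∈ S w' → w = w' := by
    intro w w' x hx hx'
    by_contra hww
    exact Set.disjoint_left.1 (hdisj hww) hx hx'
  let ε : E → Sym2 V := fun e => s(u e, v e)
  have hεinj : Function.Injective ε := by
    intro e e' hee
    apply hinj
    rcases Sym2.eq_iff.1 hee with ⟨h1, h2⟩ | ⟨h1, h2⟩
    · exact Sym2.eq_iff.2 (Or.inl ⟨huniq (hu e) (h1 ▸ hu e'), huniq (hv e) (h2 ▸ hv e')⟩)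
    · exact Sym2.eq_iff.2 (Or.inr ⟨huniq (hu e) (h1 ▸ hv e'), huniq (hv e) (h2 ▸ hu e')⟩)
  let inner : Sym2 V → Prop := fun x => ∃ w, ∀ y ∈ x, y ∈ S w
  have hεinner : ∀ e, ¬ inner (ε e) := by
    rintro e ⟨w, hw⟩
    exact hst e ((huniq (hu e) (hw _ (Sym2.mem_mk_left _ _))).trans
      (huniq (hw _ (Sym2.mem_mk_right _ _)) (hv e)))
  let D : Set (Sym2 V) := {x | x ∈ G.edgeSet ∧ ¬ inner x ∧ x ∉ Set.range ε}
  let r : F → F → Prop := fun f g => ∃ x ∈ D, x ∈ bd f ∧ x ∈ bd g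
  let inst : Fintype (Quot r) := Fintype.ofFinite _
  let N : Quot r → Sym2 V → ZMod 2 := fun c x => ∑ f, if Quot.mk r f = c ∧ x ∈ bd f then 1 else 0
  have hND : ∀ c, ∀ x ∈ D, N c x = 0 := by
    intro c x hx
    obtain ⟨f, g, hfg, hmem⟩ := hG.two_faces x hx.1
    have hq : Quot.mk r f = Quot.mk r g :=
      Quot.sound ⟨x, hx, (hmem f).2 (Or.inl rfl), (hmem g).2 (Or.inr rfl)⟩
    change ∑ k, (if Quot.mk r k = c ∧ x ∈ bd k then (1 : ZMod 2) else 0) = 0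
    rw [Fintype.sum_eq_add f g hfg (fun k hk => by simp [hmem, hk])]
    by_cases hc : Quot.mk r g = c
    · simp only [hq, hc, hmem, true_or, or_true, and_self, if_true]
      decide
    · simp [hq, hc]
  refine ⟨Quot r, inst, fun c e => N c (ε e), ?_, ?_, ?_, ?_⟩
  · intro e
    obtain ⟨f, g, hfg, hmem⟩ := hG.two_faces (ε e) (huv e)
    change ∑ c, ∑ k, (if Quot.mk r k = c ∧ ε e ∈ bd k then (1 : ZMod 2) else 0) = 0
    rw [Finset.sum_comm, Fintype.sum_eq_add f g hfg (fun k hk => by simp [hmem, hk])]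
    simp only [hmem, true_or, or_true, and_true, Finset.sum_ite_eq, Finset.mem_univ, if_true]
    decide
  · intro e
    obtain ⟨f, g, hfg, hmem⟩ := hG.two_faces (ε e) (huv e)
    refine (Set.ncard_le_ncard (t := {Quot.mk r f, Quot.mk r g}) (fun c hc => ?_)
      (Set.toFinite _)).trans ((Set.ncard_insert_le _ _).trans (by simp))
    obtain ⟨k, -, hk⟩ := Finset.exists_ne_zero_of_sum_ne_zero hc
    have hk' : Quot.mk r k = c ∧ ε e ∈ bd k := by
      by_contra h
      exact hk (if_neg h)
    rcases (hmem k).1 hk'.2 with rfl | rfl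
    · exact Or.inl hk'.1.symm
    · exact Or.inr hk'.1.symm
  · intro p c
    obtain ⟨q, hq⟩ : ∃ q : V → ZMod 2, ∀ w, ∀ x ∈ S w, q x = p w := by
      refine ⟨fun x => if h : ∃ w, x ∈ S w then p h.choose else 0, fun w x hx => ?_⟩
      have h : ∃ w, x ∈ S w := ⟨w, hx⟩
      simp only [h, dif_pos]
      rw [huniq h.choose_spec hx]
    have hzero : ∑ x, N c x * coboundary q x = 0 := by
      have h1 : ∀ x, N c x * coboundary q x =
          ∑ f, if Quot.mk r f = c then (if x ∈ bd f then coboundary q x else 0) else 0 := by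
        intro x
        rw [Finset.sum_mul]
        refine Finset.sum_congr rfl fun f _ => ?_
        split_ifs <;> simp_all
      rw [Finset.sum_congr rfl fun x _ => h1 x, Finset.sum_comm]
      refine Finset.sum_eq_zero fun f _ => ?_
      by_cases hf : Quot.mk r f = c
      · simpa [hf] using hG.sum_coboundary q f
      · simp [hf]
    rw [← hzero]
    refine Fintype.sum_of_injective ε hεinj _ _ (fun x hx => ?_) fun e => ?_
    · by_cases hxG : x ∈ G.edgeSet
      · by_cases hxi : inner x
        · obtain ⟨w, hw⟩ := hxi
          induction x using Sym2.ind with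
          | _ a b =>
            rw [coboundary_mk, hq w a (hw a (Sym2.mem_mk_left _ _)),
              hq w b (hw b (Sym2.mem_mk_right _ _)), CharTwo.add_self_eq_zero, mul_zero]
        · rw [hND c x ⟨hxG, hxi, hx⟩, zero_mul]
      · have hN : N c x = 0 :=
          Finset.sum_eq_zero fun f _ => if_neg fun h => hxG (hG.subset f x h.2)
        rw [hN, zero_mul]
    · change _ = N c (ε e) * coboundary q s(u e, v e)
      rw [coboundary_mk, hq _ _ (hu e), hq _ _ (hv e)]
  · intro h hh
    let T : Sym2 V → (F → ZMod 2) →ₗ[ZMod 2] ZMod 2 := fun x =>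
      ∑ f, if x ∈ bd f then LinearMap.proj (R := ZMod 2) (φ := fun _ => ZMod 2) f else 0
    have hT : ∀ x A, T x A = ∑ f, if x ∈ bd f then A f else 0 := by
      intro x A
      simp only [T, LinearMap.sum_apply]
      refine Finset.sum_congr rfl fun f _ => ?_
      split_ifs <;> rfl
    have hspan : (∑ e, h e • T (ε e)) ∈ Submodule.span (ZMod 2) (Set.range fun d : D => T d) := by
      apply mem_span_of_iInf_ker_le_ker
      intro A hA
      simp only [Submodule.mem_iInf, LinearMap.mem_ker] at hA ⊢
      have hr : ∀ f g, r f g → A f = A g := by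
        rintro f g ⟨x, hx, hf, hg⟩
        by_cases hfg : f = g
        · rw [hfg]
        have hAx := hA ⟨x, hx⟩
        obtain ⟨f', g', hfg', hmem⟩ := hG.two_faces x hx.1
        rw [hT, Fintype.sum_eq_add f' g' hfg' (fun k hk => by simp [hmem, hk])] at hAx
        simp only [hmem, true_or, or_true, if_true] at hAx
        have hAx' := CharTwo.add_eq_zero.1 hAx
        rcases (hmem f).1 hf with rfl | rfl <;> rcases (hmem g).1 hg with rfl | rfl <;> simp_all
      have hN : ∀ x, T x A = ∑ c, Quot.lift A hr c * N c x := by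
        intro x
        rw [hT]
        simp only [N, Finset.mul_sum]
        rw [Finset.sum_comm]
        refine Finset.sum_congr rfl fun f _ => ?_
        rw [Finset.sum_eq_single (Quot.mk r f) (fun c _ hc => by simp [hc.symm]) (by simp)]
        simp
      simp only [LinearMap.sum_apply, LinearMap.smul_apply, hN, smul_eq_mul, Finset.mul_sum]
      rw [Finset.sum_comm]
      refine Finset.sum_eq_zero fun c _ => ?_
      have := congrArg (Quot.lift A hr c * ·) (hh c)
      simp only [mul_zero, Finset.mul_sum] at this
      rw [← this]
      exact Finset.sum_congr rfl fun e _ => by ring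
    obtain ⟨k, hk⟩ := (Submodule.mem_span_range_iff_exists_fun (ZMod 2)).1 hspan
    obtain ⟨p, hp⟩ := hG.exists_potential
      (fun x => (∑ e, if ε e = x then h e else 0) + ∑ d : D, if (d : Sym2 V) = x then k d else 0) (by
        intro f
        have hkf := LinearMap.congr_fun hk (Pi.single f 1)
        simp only [LinearMap.sum_apply, LinearMap.smul_apply, hT, smul_eq_mul] at hkf
        have hs : ∀ x, (∑ g, if x ∈ bd g then (Pi.single f 1 : F → ZMod 2) g else 0) =
            if x ∈ bd f then 1 else 0 := by
          intro x
          rw [Finset.sum_eq_single f (fun g _ hg => by simp [hg]) (by simp)]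
          simp
        simp only [hs] at hkf
        rw [Finset.sum_add_distrib, Finset.sum_comm,
          Finset.sum_comm (s := bd f) (t := (Finset.univ : Finset D))]
        simp only [Finset.sum_ite_eq]
        simp only [mul_ite, mul_one, mul_zero] at hkf
        rw [hkf, CharTwo.add_self_eq_zero])
    have hinner : ∀ x ∈ G.edgeSet, inner x → coboundary p x = 0 := by
      intro x hx hxi
      rw [← hp x hx, Finset.sum_eq_zero, Finset.sum_eq_zero, add_zero]
      · rintro d -
        exact if_neg fun hd : (d : Sym2 V) = x => d.2.2.1 (hd ▸ hxi)
      · rintro e -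
        exact if_neg fun he : ε e = x => hεinner e (he ▸ hxi)
    have hconst : ∀ w, ∀ x ∈ S w, ∀ y ∈ S w, p x = p y := by
      intro w x hx y hy
      obtain ⟨q⟩ := (hconn w).preconnected ⟨x, hx⟩ ⟨y, hy⟩
      have : ∀ {a b : S w}, (G.induce (S w)).Walk a b → p a = p b := by
        intro a b q
        induction q with
        | nil => rfl
        | @cons a b c hab _ ih =>
          rw [← ih]
          refine CharTwo.add_eq_zero.1 (hinner s(a.1, b.1) hab ⟨w, fun y hy => ?_⟩)
          rcases Sym2.mem_iff.1 hy with rfl | rfl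
          · exact a.2
          · exact b.2
      exact this q
    choose ρ hρ using hne
    refine ⟨fun w => p (ρ w), fun e => ?_⟩
    have hpe := hp (ε e) (huv e)
    rw [Finset.sum_eq_single e (fun e' _ he' => if_neg fun h0 => he' (hεinj h0)) (by simp),
      Finset.sum_eq_zero (fun d _ => if_neg fun hd => d.2.2.2 ⟨e, hd.symm⟩), if_pos rfl,
      add_zero] at hpe
    change h e = p (ρ (s e)) + p (ρ (t e))
    rw [hpe, hconst _ _ (hρ (s e)) _ (hu e), hconst _ _ (hρ (t e)) _ (hv e)]
    rfl

/-- Euler's formula bounds the number of edges of a minor in which every nonempty edge set without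
vertices of degree one has at least `g` edges. -/
lemma IsSphericalFaces.minor_edge_bound {V W E F : Type} [Fintype V] [DecidableEq V] [Fintype E]
    [Fintype F] [Fintype W] [Nonempty W] {G : SimpleGraph V} {bd : F → Finset (Sym2 V)}
    (hG : IsSphericalFaces G bd) {P : SimpleGraph W} (hP : HasMinor G P)
    (s t : E → W) (hadj : ∀ e, P.Adj (s e) (t e))
    (hinj : Function.Injective fun e => s(s e, t e))
    (hE : Fintype.card W ≤ Fintype.card E) (g : ℕ)
    (hg : ∀ z : E → ZMod 2, (∀ e, z e ≠ 0 → ∀ w ∈ s(s e, t e),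
      ∃ e', e' ≠ e ∧ z e' ≠ 0 ∧ w ∈ s(s e', t e')) → (∃ e, z e ≠ 0) → g ≤ {e | z e ≠ 0}.ncard) :
    (Fintype.card E + 2 - Fintype.card W) * g ≤ Fintype.card E * 2 := by
  classical
  obtain ⟨S, hne, hconn, hdisj, hS⟩ := hP
  obtain ⟨F', _, z, h0, h2, hcob, hpot⟩ := hG.exists_minor_faces S hne hconn hdisj s t
    (fun e => (hadj e).ne) hinj fun e => hS _ _ (hadj e)
  have h1 := euler_inequality s t z h0 hpot hE
  have h3 := girth_mul_faces_le z g h2 fun f hf => by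
    refine hg (z f) (fun e he w hw => ?_) (Function.ne_iff.1 hf)
    by_contra! hno
    have h := hcob (Pi.single w 1) f
    rw [Finset.sum_eq_single e (fun e' _ he' => ?_) (by simp)] at h
    · have hst := (hadj e).ne
      rcases Sym2.mem_iff.1 hw with rfl | rfl
      · simp [hst.symm, he] at h
      · simp [hst, he] at h
    · by_cases hz : z f e' = 0
      · rw [hz, zero_mul]
      · have hw' := hno e' he' hz
        rw [Sym2.mem_iff, not_or] at hw'
        simp [Ne.symm hw'.1, Ne.symm hw'.2]
  exact (Nat.mul_le_mul_right g (by omega)).trans h3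

/-- A graph with a spherical system of faces has no `K₅` minor. -/
lemma IsSphericalFaces.not_hasMinor_top {V F : Type} [Fintype V] [DecidableEq V] [Fintype F]
    {G : SimpleGraph V} {bd : F → Finset (Sym2 V)} (hG : IsSphericalFaces G bd) :
    ¬ HasMinor G (⊤ : SimpleGraph (Fin 5)) := by
  intro hP
  let s : Fin 10 → Fin 5 := ![0, 0, 0, 0, 1, 1, 1, 2, 2, 3]
  let t : Fin 10 → Fin 5 := ![1, 2, 3, 4, 2, 3, 4, 3, 4, 4]
  have hst : ∀ e, s e ≠ t e := by decide
  have hinj : Function.Injective fun e => s(s e, t e) := by decide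
  have := hG.minor_edge_bound hP s t hst hinj (by simp) 3 (by
    intro z hz ⟨e, he⟩
    obtain ⟨e₁, h₁, hz₁, hs₁⟩ := hz e he (s e) (Sym2.mem_mk_left _ _)
    obtain ⟨e₂, h₂, hz₂, ht₂⟩ := hz e he (t e) (Sym2.mem_mk_right _ _)
    have h₁₂ : e₁ ≠ e₂ := by
      rintro rfl
      exact h₁ (hinj ((Sym2.mem_and_mem_iff (hst e)).1 ⟨hs₁, ht₂⟩))
    rw [← Finset.card_eq_three.2 ⟨e, e₁, e₂, h₁.symm, h₂.symm, h₁₂, rfl⟩,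
      ← Set.ncard_coe_finset]
    refine Set.ncard_le_ncard ?_ (Set.toFinite _)
    simp [Set.insert_subset_iff, he, hz₁, hz₂])
  simp at this

/-- A graph with a spherical system of faces has no `K_{3,3}` minor. -/
lemma IsSphericalFaces.not_hasMinor_completeBipartiteGraph {V F : Type} [Fintype V]
    [DecidableEq V] [Fintype F] {G : SimpleGraph V} {bd : F → Finset (Sym2 V)}
    (hG : IsSphericalFaces G bd) :
    ¬ HasMinor G (completeBipartiteGraph (Fin 3) (Fin 3)) := by
  intro hP
  have := hG.minor_edge_bound hP (E := Fin 3 × Fin 3) (fun e => Sum.inl e.1)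
    (fun e => Sum.inr e.2) (by simp) (by decide) (by simp) 4 (by
      intro z hz ⟨e, he⟩
      obtain ⟨e₁, h₁, hz₁, hs₁⟩ := hz e he (Sum.inl e.1) (Sym2.mem_mk_left _ _)
      obtain ⟨e₂, h₂, hz₂, hs₂⟩ := hz e he (Sum.inr e.2) (Sym2.mem_mk_right _ _)
      obtain ⟨e₃, h₃, hz₃, hs₃⟩ := hz e₂ hz₂ (Sum.inl e₂.1) (Sym2.mem_mk_left _ _)
      simp only [Sym2.mem_iff, Sum.inl.injEq, Sum.inr.injEq, reduceCtorEq, or_false,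
        false_or] at hs₁ hs₂ hs₃
      have hcard : ({e, e₁, e₂, e₃} : Finset (Fin 3 × Fin 3)).card = 4 := by
        rw [Finset.card_insert_of_notMem, Finset.card_insert_of_notMem,
          Finset.card_pair h₃.symm] <;>
          simp only [Finset.mem_insert, Finset.mem_singleton] <;> grind
      rw [← hcard, ← Set.ncard_coe_finset]
      refine Set.ncard_le_ncard ?_ (Set.toFinite _)
      simp [Set.insert_subset_iff, he, hz₁, hz₂, hz₃])
  simp at this

/-- The cyclic successor on `Fin n`. -/
def cyclicSucc {n : ℕ} (i : Fin n) : Fin n :=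
  if h : (i : ℕ) + 1 < n then ⟨i + 1, h⟩ else ⟨0, i.pos⟩

lemma cyclicSucc_eq_iff {n : ℕ} (hn : 3 ≤ n) (i j : Fin n) :
    cyclicSucc i = j ↔ (i : ℕ) + 1 = j ∨ ((j : ℕ) = 0 ∧ (i : ℕ) = n - 1) := by
  unfold cyclicSucc
  split_ifs with h <;> rw [Fin.ext_iff] <;> simp only <;> omega

lemma cyclicSucc_injective {n : ℕ} : Function.Injective (cyclicSucc (n := n)) := by
  intro i j h
  unfold cyclicSucc at h
  split_ifs at h <;> rw [Fin.ext_iff] at h ⊢ <;> simp only at h <;> omega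

lemma cyclicSucc_surjective {n : ℕ} : Function.Surjective (cyclicSucc (n := n)) :=
  Finite.surjective_of_injective cyclicSucc_injective

lemma cyclicSucc_ne {n : ℕ} (hn : 3 ≤ n) (i : Fin n) : cyclicSucc i ≠ i := by
  rw [Ne, cyclicSucc_eq_iff hn]
  omega

lemma cyclicSucc_cyclicSucc_ne {n : ℕ} (hn : 3 ≤ n) (i : Fin n) :
    cyclicSucc (cyclicSucc i) ≠ i := by
  rw [Ne, cyclicSucc_eq_iff hn]
  unfold cyclicSucc
  split_ifs <;> simp only <;> omega

/-- A function on `Fin n` that is invariant under the cyclic successor is constant. -/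
lemma eq_of_cyclicSucc_invariant {n : ℕ} {M : Type} (g : Fin n → M)
    (hg : ∀ i, g (cyclicSucc i) = g i) (i j : Fin n) : g i = g j := by
  have h : ∀ k (hk : k < n), g ⟨k, hk⟩ = g ⟨0, by omega⟩ := by
    intro k
    induction k with
    | zero => intro _; rfl
    | succ k ih =>
      intro hk
      rw [← ih (by omega), ← hg ⟨k, by omega⟩]
      simp [cyclicSucc, hk]
  exact (h i i.2).trans (h j j.2).symm

/-- The triangular faces of `Dr n`: for each `i`, a triangle at each hub and two triangles in the
band between the two cycles. -/
def drFace {n : ℕ} : Fin 4 × Fin n → Finset (Sym2 (Bool ⊕ Bool × Fin n))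
  | (0, i) => {s(.inl false, .inr (false, i)), s(.inl false, .inr (false, cyclicSucc i)),
      s(.inr (false, i), .inr (false, cyclicSucc i))}
  | (1, i) => {s(.inr (false, i), .inr (false, cyclicSucc i)), s(.inr (false, i), .inr (true, i)),
      s(.inr (false, cyclicSucc i), .inr (true, i))}
  | (2, i) => {s(.inr (false, cyclicSucc i), .inr (true, i)),
      s(.inr (false, cyclicSucc i), .inr (true, cyclicSucc i)),
      s(.inr (true, i), .inr (true, cyclicSucc i))}
  | (3, i) => {s(.inr (true, i), .inr (true, cyclicSucc i)), s(.inl true, .inr (true, i)),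
      s(.inl true, .inr (true, cyclicSucc i))}

lemma mem_edgeSet_Dr {n : ℕ} (hn : 3 ≤ n) (x : Sym2 (Bool ⊕ Bool × Fin n)) :
    x ∈ (Dr n).edgeSet ↔ ∃ i, x = s(.inl false, .inr (false, i)) ∨
      x = s(.inl true, .inr (true, i)) ∨
      x = s(.inr (false, i), .inr (false, cyclicSucc i)) ∨
      x = s(.inr (true, i), .inr (true, cyclicSucc i)) ∨
      x = s(.inr (false, i), .inr (true, i)) ∨
      x = s(.inr (false, cyclicSucc i), .inr (true, i)) := by
  have hne := cyclicSucc_ne hn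
  have hne' := fun i => (hne i).symm
  have hs := fun i j : Fin n => cyclicSucc_eq_iff hn i j
  induction x using Sym2.ind with
  | _ u v =>
    rw [SimpleGraph.mem_edgeSet, Dr, SimpleGraph.fromRel_adj]
    constructor
    · rcases u with (_ | _) | ⟨_ | _, i⟩ <;> rcases v with (_ | _) | ⟨_ | _, j⟩ <;>
        simp <;> grind [Fin.ext_iff]
    · rintro ⟨i, h⟩
      have := (hs i _).1 rfl
      rcases h with h | h | h | h | h | h <;>
        rcases Sym2.eq_iff.1 h with ⟨rfl, rfl⟩ | ⟨rfl, rfl⟩ <;>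
        simp [hne, hne'] <;> omega

lemma isSphericalFaces_drFace {n : ℕ} (hn : 3 ≤ n) : IsSphericalFaces (Dr n) drFace := by
  have hne := cyclicSucc_ne hn
  have hne' := fun i => (hne i).symm
  have hne2 := cyclicSucc_cyclicSucc_ne hn
  have hinj := fun i j : Fin n => (cyclicSucc_injective (n := n)).eq_iff (a := i) (b := j)
  have hsum : ∀ (h : Sym2 (Bool ⊕ Bool × Fin n) → ZMod 2) (i : Fin n),
      (∑ x ∈ drFace (0, i), h x = h s(.inl false, .inr (false, i)) +
        (h s(.inl false, .inr (false, cyclicSucc i)) +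
        h s(.inr (false, i), .inr (false, cyclicSucc i)))) ∧
      (∑ x ∈ drFace (1, i), h x = h s(.inr (false, i), .inr (false, cyclicSucc i)) +
        (h s(.inr (false, i), .inr (true, i)) +
        h s(.inr (false, cyclicSucc i), .inr (true, i)))) ∧
      (∑ x ∈ drFace (2, i), h x = h s(.inr (false, cyclicSucc i), .inr (true, i)) +
        (h s(.inr (false, cyclicSucc i), .inr (true, cyclicSucc i)) +
        h s(.inr (true, i), .inr (true, cyclicSucc i)))) ∧
      ∑ x ∈ drFace (3, i), h x = h s(.inr (true, i), .inr (true, cyclicSucc i)) +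
        (h s(.inl true, .inr (true, i)) + h s(.inl true, .inr (true, cyclicSucc i))) := by
    intro h i
    refine ⟨?_, ?_, ?_, ?_⟩ <;> unfold drFace <;>
      rw [Finset.sum_insert, Finset.sum_insert, Finset.sum_singleton] <;>
      simp [hne, hne']
  refine ⟨?_, ?_, ?_, ?_⟩
  · rintro ⟨k, i⟩ x hx
    rw [mem_edgeSet_Dr hn]
    fin_cases k <;> simp only [drFace, Finset.mem_insert, Finset.mem_singleton] at hx <;>
      rcases hx with rfl | rfl | rfl
    all_goals first
      | (refine ⟨i, ?_⟩; simp; done)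
      | (refine ⟨cyclicSucc i, ?_⟩; simp)
  · intro x hx
    obtain ⟨i, hx⟩ := (mem_edgeSet_Dr hn x).1 hx
    obtain ⟨j, rfl⟩ := cyclicSucc_surjective i
    rcases hx with rfl | rfl | rfl | rfl | rfl | rfl
    · refine ⟨(0, j), (0, cyclicSucc j), ?_, ?_⟩
      · simp [hne']
      rintro ⟨k, i⟩
      fin_cases k <;> simp [drFace] <;> grind
    · refine ⟨(3, j), (3, cyclicSucc j), ?_, ?_⟩
      · simp [hne']
      rintro ⟨k, i⟩
      fin_cases k <;> simp [drFace] <;> grind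
    · refine ⟨(0, cyclicSucc j), (1, cyclicSucc j), by simp, ?_⟩
      rintro ⟨k, i⟩
      fin_cases k <;> simp [drFace] <;> grind
    · refine ⟨(2, cyclicSucc j), (3, cyclicSucc j), by simp, ?_⟩
      rintro ⟨k, i⟩
      fin_cases k <;> simp [drFace] <;> grind
    · refine ⟨(2, j), (1, cyclicSucc j), by simp, ?_⟩
      rintro ⟨k, i⟩
      fin_cases k <;> simp [drFace] <;> grind
    · refine ⟨(1, cyclicSucc j), (2, cyclicSucc j), by simp, ?_⟩
      rintro ⟨k, i⟩
      fin_cases k <;> simp [drFace] <;> grind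
  · rintro p ⟨k, i⟩
    have h := hsum (coboundary p) i
    fin_cases k
    · exact h.1.trans (by simp only [coboundary_mk]; grind)
    · exact h.2.1.trans (by simp only [coboundary_mk]; grind)
    · exact h.2.2.1.trans (by simp only [coboundary_mk]; grind)
    · exact h.2.2.2.trans (by simp only [coboundary_mk]; grind)
  · intro h hh
    have e0 := fun i => (hsum h i).1.symm.trans (hh (0, i))
    have e1 := fun i => (hsum h i).2.1.symm.trans (hh (1, i))
    have e2 := fun i => (hsum h i).2.2.1.symm.trans (hh (2, i))
    have e3 := fun i => (hsum h i).2.2.2.symm.trans (hh (3, i))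
    let a : Fin n → ZMod 2 := fun i => h s(.inl false, .inr (false, i))
    let b : Fin n → ZMod 2 := fun i => a i + h s(.inr (false, i), .inr (true, i))
    let c : Fin n → ZMod 2 := fun i => b i + h s(.inl true, .inr (true, i))
    have hc : ∀ i j, c i = c j := eq_of_cyclicSucc_invariant c fun i => by
      have := e0 i; have := e1 i; have := e2 i; have := e3 i
      grind
    let p : Bool ⊕ Bool × Fin n → ZMod 2
      | .inl false => 0
      | .inl true => c ⟨0, by omega⟩
      | .inr (false, i) => a i
      | .inr (true, i) => b i
    refine ⟨p, fun x hx => ?_⟩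
    obtain ⟨i, hx⟩ := (mem_edgeSet_Dr hn x).1 hx
    have := e0 i; have := e1 i; have := e2 i; have := hc ⟨0, by omega⟩ i
    rcases hx with rfl | rfl | rfl | rfl | rfl | rfl <;> rw [coboundary_mk] <;>
      simp only [p] <;> grind

/-- For every `n ≥ 3`, the graph `D n` is planar. -/
theorem Dr_planar (n : ℕ) (hn : 3 ≤ n) : IsPlanar (Dr n) := by
  exact ⟨(isSphericalFaces_drFace hn).not_hasMinor_top,
    (isSphericalFaces_drFace hn).not_hasMinor_completeBipartiteGraph⟩
end

section
/- Let G_∞ be the infinite ladder-with-hubs graph and H a finite K_4-free, K_5-minor-free graph. Then for every homomorphism f : G_∞ → H there exist m ≥ 4 and an embedding (injective strong homomorphism) ĝ : D_m → H such that f = ĝ ∘ δ_{∞,m}. -/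
/-- The infinite ladder-with-hubs graph `G∞`: vertices `v₁ = Sum.inl false`,
`v₂ = Sum.inl true`, `a i = Sum.inr (false, i)`, `b i = Sum.inr (true, i)` for `i : ℕ`,
with edges `(v₁, a i)`, `(v₂, b i)`, `(a i, b i)`, `(a i, a (i+1))`, `(b i, b (i+1))`,
`(a (i+1), b i)` for all `i`. -/
def Ginf : SimpleGraph (Bool ⊕ Bool × ℕ) :=
  SimpleGraph.fromRel (fun u v =>
    match u, v with
    | Sum.inl c, Sum.inr (d, _) => c = d
    | Sum.inr (false, i), Sum.inr (true, j) => i = j ∨ i = j + 1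
    | Sum.inr (false, i), Sum.inr (false, j) => i + 1 = j
    | Sum.inr (true, i), Sum.inr (true, j) => i + 1 = j
    | _, _ => False)

/-- Two vertex sets touch in `H` if they are disjoint and joined by an edge of `H`. -/
def Touch {W : Type} (H : SimpleGraph W) (A B : Set W) : Prop :=
  Disjoint A B ∧ ∃ u ∈ A, ∃ v ∈ B, H.Adj u v

theorem Touch.symm {W : Type} {H : SimpleGraph W} {A B : Set W} (h : Touch H A B) :
    Touch H B A := by
  obtain ⟨hd, u, hu, v, hv, huv⟩ := h
  exact ⟨hd.symm, v, hv, u, hu, huv.symm⟩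

theorem hasMinor_top_five {W : Type} {H : SimpleGraph W} {A B C D E : Set W}
    (hA : (H.induce A).Connected) (hB : (H.induce B).Connected) (hC : (H.induce C).Connected)
    (hD : (H.induce D).Connected) (hE : (H.induce E).Connected)
    (hAB : Touch H A B) (hAC : Touch H A C) (hAD : Touch H A D) (hAE : Touch H A E)
    (hBC : Touch H B C) (hBD : Touch H B D) (hBE : Touch H B E)
    (hCD : Touch H C D) (hCE : Touch H C E) (hDE : Touch H D E) :
    HasMinor H (⊤ : SimpleGraph (Fin 5)) := by
  have hconn : ∀ i, (H.induce ((![A, B, C, D, E] : Fin 5 → Set W) i)).Connected := by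
    simp only [Fin.forall_fin_succ]
    exact ⟨hA, hB, hC, hD, hE, fun i => i.elim0⟩
  have hlt : ∀ i j : Fin 5, i < j →
      Touch H ((![A, B, C, D, E] : Fin 5 → Set W) i) ((![A, B, C, D, E] : Fin 5 → Set W) j) := by
    intro i j hij
    fin_cases i <;> fin_cases j <;> first | exact absurd hij (by decide) | assumption
  have hne : ∀ i j : Fin 5, i ≠ j →
      Touch H ((![A, B, C, D, E] : Fin 5 → Set W) i) ((![A, B, C, D, E] : Fin 5 → Set W) j) := by
    intro i j hij
    rcases lt_or_gt_of_ne hij with h | h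
    · exact hlt i j h
    · exact (hlt j i h).symm
  exact ⟨![A, B, C, D, E], fun i => Set.nonempty_coe_sort.mp (hconn i).nonempty, hconn,
    fun i j hij => (hne i j hij).1, fun i j hij => (hne i j hij).2⟩

theorem induce_singleton_connected {W : Type} (H : SimpleGraph W) (v : W) :
    (H.induce {v}).Connected :=
  have : Nonempty ({v} : Set W) := ⟨⟨v, rfl⟩⟩
  ⟨SimpleGraph.Preconnected.of_subsingleton⟩

theorem induce_insert_connected {W : Type} {H : SimpleGraph W} {S : Set W} {u v : W}
    (hS : (H.induce S).Connected) (hu : u ∈ S) (huv : H.Adj v u) :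
    (H.induce (insert v S)).Connected := by
  have h := SimpleGraph.induce_union_connected
    (SimpleGraph.induce_pair_connected_of_adj huv).preconnected hS.preconnected
    ⟨u, by simp, hu⟩
  have hset : ({v, u} : Set W) ∪ S = insert v S := by
    ext w
    simp only [Set.mem_union, Set.mem_insert_iff, Set.mem_singleton_iff]
    grind
  rwa [hset] at h

theorem induce_image_Ico_connected {W : Type} {H : SimpleGraph W} {x : ℕ → W}
    (hx : ∀ k, H.Adj (x k) (x (k + 1))) {a b : ℕ} (hab : a < b) :
    (H.induce (x '' Set.Ico a b)).Connected := by
  induction b, hab using Nat.le_induction with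
  | base =>
    have hset : Set.Ico a (a + 1) = {a} := by
      ext k
      simp only [Set.mem_Ico, Set.mem_singleton_iff]
      lia
    rw [hset, Set.image_singleton]
    exact induce_singleton_connected H (x a)
  | succ b hab ih =>
    have hset : x '' Set.Ico a (b + 1) = insert (x b) (x '' Set.Ico a b) := by
      rw [← Set.image_insert_eq]
      congr 1
      ext k
      simp only [Set.mem_insert_iff, Set.mem_Ico]
      lia
    rw [hset]
    obtain ⟨c, rfl⟩ : ∃ c, b = c + 1 := ⟨b - 1, by lia⟩
    exact induce_insert_connected ih ⟨c, ⟨by lia, by lia⟩, rfl⟩ (hx c).symm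

theorem not_four_clique {W : Type} {H : SimpleGraph W} (hK4 : H.CliqueFree 4) {a b c d : W}
    (hab : H.Adj a b) (hac : H.Adj a c) (had : H.Adj a d) (hbc : H.Adj b c) (hbd : H.Adj b d)
    (hcd : H.Adj c d) : False := by
  classical
  exact hK4 _ ((SimpleGraph.is3Clique_triple_iff.2 ⟨hbc, hbd, hcd⟩).insert (a := a)
    (by simp [hab, hac, had]))

/-- Distinctness at distances less than `n` is injectivity on every window of length `n`. -/
theorem injOn_Ico_of_forall_ne {W : Type} {x : ℕ → W} {n : ℕ}
    (hgap : ∀ i j, i < j → j < i + n → x i ≠ x j) (k : ℕ) :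
    Set.InjOn (fun i => x (k + i)) (Set.Ico 0 n) := by
  rintro i ⟨_, hi⟩ j ⟨_, hj⟩ hij
  rcases lt_trichotomy i j with hlt | rfl | hlt
  · exact absurd hij (hgap _ _ (by lia) (by lia))
  · rfl
  · exact absurd hij.symm (hgap _ _ (by lia) (by lia))

theorem disjoint_image_Ico {W : Type} {x : ℕ → W} {n : ℕ} (hinj : Set.InjOn x (Set.Ico 0 n))
    (a b c d : ℕ) (hbc : b ≤ c) (hdn : d ≤ n) :
    Disjoint (x '' Set.Ico a b) (x '' Set.Ico c d) := by
  rw [Set.disjoint_left]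
  rintro _ ⟨i, ⟨_, hi⟩, rfl⟩ ⟨j, ⟨hj, hj'⟩, hij⟩
  have := hinj ⟨by lia, by lia⟩ ⟨by lia, by lia⟩ hij
  lia

/-- The square of the one-way infinite path `x 0, x 1, …`, with the hub `p` joined to the even
positions and the hub `q` to the odd ones. -/
structure Strip {W : Type} (H : SimpleGraph W) (p q : W) (x : ℕ → W) : Prop where
  adj_one : ∀ k, H.Adj (x k) (x (k + 1))
  adj_two : ∀ k, H.Adj (x k) (x (k + 2))
  adj_even : ∀ k, k % 2 = 0 → H.Adj p (x k)
  adj_odd : ∀ k, k % 2 = 1 → H.Adj q (x k)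

namespace Strip

variable {W : Type} {H : SimpleGraph W} {p q : W} {x : ℕ → W} {n : ℕ}

theorem shift (h : Strip H p q x) {k : ℕ} (hk : k % 2 = 0) :
    Strip H p q (fun i => x (k + i)) :=
  ⟨fun i => h.adj_one (k + i), fun i => h.adj_two (k + i),
    fun i hi => h.adj_even _ (by lia), fun i hi => h.adj_odd _ (by lia)⟩

theorem shift_swap (h : Strip H p q x) {k : ℕ} (hk : k % 2 = 1) :
    Strip H q p (fun i => x (k + i)) :=
  ⟨fun i => h.adj_one (k + i), fun i => h.adj_two (k + i),
    fun i hi => h.adj_odd _ (by lia), fun i hi => h.adj_even _ (by lia)⟩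

theorem exists_shift (h : Strip H p q x) (k : ℕ) :
    ∃ p' q', Strip H p' q' (fun i => x (k + i)) := by
  rcases Nat.mod_two_eq_zero_or_one k with hk | hk
  · exact ⟨p, q, h.shift hk⟩
  · exact ⟨q, p, h.shift_swap hk⟩

theorem not_adj_three (h : Strip H p q x) (hK4 : H.CliqueFree 4) (k : ℕ) :
    ¬ H.Adj (x k) (x (k + 3)) := fun h3 =>
  not_four_clique hK4 (h.adj_one k) (h.adj_two k) h3 (h.adj_one (k + 1)) (h.adj_two (k + 1))
    (h.adj_one (k + 2))

theorem not_adj_hub_odd (h : Strip H p q x) (hK4 : H.CliqueFree 4) {k : ℕ} (hk : k % 2 = 1) :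
    ¬ H.Adj p (x k) := by
  intro hp
  obtain ⟨j, rfl⟩ : ∃ j, k = j + 1 := ⟨k - 1, by lia⟩
  exact not_four_clique hK4 (h.adj_even j (by lia)) hp (h.adj_even (j + 2) (by lia))
    (h.adj_one j) (h.adj_two j) (h.adj_one (j + 1))

theorem not_adj_hub_even (h : Strip H p q x) (hK4 : H.CliqueFree 4) {k : ℕ} (hk : k % 2 = 0)
    (hpos : 0 < k) : ¬ H.Adj q (x k) := by
  obtain ⟨j, rfl⟩ : ∃ j, k = 1 + j := ⟨k - 1, by lia⟩
  exact (h.shift_swap (k := 1) rfl).not_adj_hub_odd hK4 (k := j) (by lia)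

theorem hub_ne_hub (h : Strip H p q x) (hK4 : H.CliqueFree 4) : p ≠ q := fun hpq =>
  h.not_adj_hub_odd hK4 (k := 1) rfl (hpq ▸ h.adj_odd 1 rfl)

theorem even_hub_ne (h : Strip H p q x) (hK4 : H.CliqueFree 4) (k : ℕ) : p ≠ x k := by
  rcases Nat.mod_two_eq_zero_or_one k with hk | hk
  · exact (h.adj_even k hk).ne
  · intro hp
    exact h.not_adj_hub_odd hK4 (k := k + 2) (by lia) (hp ▸ h.adj_two k)

theorem touch_even_hub (h : Strip H p q x) (hK4 : H.CliqueFree 4) (a b k : ℕ) (hk : k % 2 = 0)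
    (hak : a ≤ k) (hkb : k < b) : Touch H {p} (x '' Set.Ico a b) := by
  refine ⟨?_, p, rfl, x k, ⟨k, ⟨hak, hkb⟩, rfl⟩, h.adj_even k hk⟩
  rw [Set.disjoint_singleton_left]
  rintro ⟨i, _, hi⟩
  exact h.even_hub_ne hK4 i hi.symm

theorem odd_hub_ne (h : Strip H p q x) (hK4 : H.CliqueFree 4) (k : ℕ) : q ≠ x k := by
  rcases Nat.mod_two_eq_zero_or_one k with hk | hk
  · intro hq
    exact h.not_adj_hub_even hK4 (k := k + 2) (by lia) (by lia) (hq ▸ h.adj_two k)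
  · exact (h.adj_odd k hk).ne

theorem mod_two_eq (h : Strip H p q x) (hK4 : H.CliqueFree 4) {i j : ℕ} (hij : x i = x j) :
    i % 2 = j % 2 := by
  rcases Nat.mod_two_eq_zero_or_one i with hi | hi <;>
    rcases Nat.mod_two_eq_zero_or_one j with hj | hj
  · lia
  · exact absurd (hij ▸ h.adj_even i hi) (h.not_adj_hub_odd hK4 hj)
  · exact absurd (hij ▸ h.adj_even j hj) (h.not_adj_hub_odd hK4 hi)
  · lia

theorem eight_le (h : Strip H p q x) (hK4 : H.CliqueFree 4) (hn : x n = x 0) (hpos : 0 < n) :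
    8 ≤ n := by
  have hmod := h.mod_two_eq hK4 hn
  by_contra! hlt
  obtain rfl | rfl | rfl : n = 2 ∨ n = 4 ∨ n = 6 := by lia
  · exact (h.adj_two 0).ne hn.symm
  · exact h.not_adj_three hK4 0 (hn ▸ (h.adj_one 3).symm)
  · exact not_four_clique hK4 (h.adj_even 0 rfl) (h.adj_even 2 rfl) (h.adj_even 4 rfl)
      (h.adj_two 0) (hn ▸ (h.adj_two 4).symm) (h.adj_two 2)

/-- A connection between the two hubs outside a closed strip yields a `K₅`-minor. -/
theorem minor_of_hub_connection (h : Strip H p q x) (hK4 : H.CliqueFree 4) (hn8 : 8 ≤ n)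
    (hinj : Set.InjOn x (Set.Ico 0 n)) (hn : x n = x 0) {Q : Set W}
    (hQ : (H.induce Q).Connected) (hqQ : q ∈ Q) (hpQ : p ∉ Q)
    (hxQ : ∀ k < n, x k ∉ Q) (hadj : ∃ z ∈ Q, H.Adj p z) :
    HasMinor H (⊤ : SimpleGraph (Fin 5)) := by
  have hdisj := disjoint_image_Ico hinj
  have hp := h.touch_even_hub hK4
  have hq : ∀ a b k, k % 2 = 1 → a ≤ k → k < b → b ≤ n → Touch H Q (x '' Set.Ico a b) := by
    intro a b k hk hak hkb hbn
    refine ⟨?_, q, hqQ, x k, ⟨k, ⟨hak, hkb⟩, rfl⟩, h.adj_odd k hk⟩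
    rw [Set.disjoint_right]
    rintro _ ⟨i, ⟨_, hi⟩, rfl⟩
    exact hxQ i (by lia)
  obtain ⟨m, rfl⟩ : ∃ m, n = m + 1 := ⟨n - 1, by lia⟩
  refine hasMinor_top_five (induce_singleton_connected H p) hQ
    (induce_image_Ico_connected h.adj_one (show 0 < 2 by lia))
    (induce_image_Ico_connected h.adj_one (show 2 < 4 by lia))
    (induce_image_Ico_connected h.adj_one (show 4 < m + 1 by lia))
    ⟨Set.disjoint_singleton_left.2 hpQ, p, rfl, hadj⟩
    (hp _ _ 0 rfl (by lia) (by lia)) (hp _ _ 2 rfl (by lia) (by lia))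
    (hp _ _ 4 rfl (by lia) (by lia))
    (hq _ _ 1 rfl (by lia) (by lia) (by lia)) (hq _ _ 3 rfl (by lia) (by lia) (by lia))
    (hq _ _ 5 rfl (by lia) (by lia) (by lia))
    ⟨hdisj _ _ _ _ (by lia) (by lia), x 1, ⟨1, by simp, rfl⟩, x 2, ⟨2, by simp, rfl⟩,
      h.adj_one 1⟩
    ⟨hdisj _ _ _ _ (by lia) (by lia), x 0, ⟨0, by simp, rfl⟩, x m, ⟨m, ⟨by lia, by lia⟩, rfl⟩, ?_⟩
    ⟨hdisj _ _ _ _ (by lia) (by lia), x 3, ⟨3, by simp, rfl⟩, x 4, ⟨4, ⟨le_rfl, by lia⟩, rfl⟩,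
      h.adj_one 3⟩
  exact hn ▸ (h.adj_one m).symm

/-- A closed strip in which `u` plays the role of `x 1` and the odd hub has a further common
neighbour `w` with `x 0` yields a `K₅`-minor. -/
theorem minor_of_odd_hub_detour (h : Strip H p q x) (hK4 : H.CliqueFree 4) (hn8 : 8 ≤ n)
    (hinj : Set.InjOn x (Set.Ico 0 n)) (hn : x n = x 0) (heven : n % 2 = 0) {u w : W}
    (hux : ∀ k < n, k ≠ 1 → u ≠ x k) (hwx : ∀ k < n, k ≠ 1 → w ≠ x k) (huw : u ≠ w)
    (hup : u ≠ p) (hwp : w ≠ p) (hu2 : H.Adj u (x 2)) (hun : H.Adj u (x (n - 1)))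
    (hqu : H.Adj q u) (hqw : H.Adj q w) (hw0 : H.Adj w (x 0)) :
    HasMinor H (⊤ : SimpleGraph (Fin 5)) := by
  obtain ⟨m, rfl⟩ : ∃ m, n = m + 2 := ⟨n - 2, by lia⟩
  have hxx : ∀ i < m + 2, ∀ j < m + 2, i ≠ j → x i ≠ x j := fun i hi j hj hij hne =>
    hij (hinj ⟨by lia, hi⟩ ⟨by lia, hj⟩ hne)
  have hp := h.even_hub_ne hK4
  have hq := h.odd_hub_ne hK4
  have hpq := h.hub_ne_hub hK4
  have h0m : H.Adj (x 0) (x (m + 1)) := hn ▸ (h.adj_one (m + 1)).symm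
  have hqne := hqu.ne
  have hqne' := hqw.ne
  have h45 : (H.induce {p, x 4, x 5}).Connected :=
    induce_insert_connected (SimpleGraph.induce_pair_connected_of_adj (h.adj_one 4))
      (u := x 4) (by simp) (h.adj_even 4 rfl)
  refine hasMinor_top_five (induce_singleton_connected H (x 0))
    (SimpleGraph.induce_pair_connected_of_adj hu2)
    (SimpleGraph.induce_pair_connected_of_adj (h.adj_one m)) h45
    (SimpleGraph.induce_pair_connected_of_adj hqw)
    ⟨?_, x 0, by simp, x 2, by simp, h.adj_two 0⟩
    ⟨?_, x 0, by simp, x (m + 1), by simp, h0m⟩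
    ⟨?_, x 0, by simp, p, by simp, (h.adj_even 0 rfl).symm⟩
    ⟨?_, x 0, by simp, w, by simp, hw0.symm⟩
    ⟨?_, u, by simp, x (m + 1), by simp, hun⟩
    ⟨?_, x 2, by simp, p, by simp, (h.adj_even 2 rfl).symm⟩
    ⟨?_, u, by simp, q, by simp, hqu.symm⟩
    ⟨?_, x m, by simp, p, by simp, (h.adj_even m (by lia)).symm⟩
    ⟨?_, x (m + 1), by simp, q, by simp, (h.adj_odd (m + 1) (by lia)).symm⟩
    ⟨?_, x 5, by simp, q, by simp, (h.adj_odd 5 rfl).symm⟩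
  all_goals
    simp only [Set.disjoint_left, Set.mem_insert_iff, Set.mem_singleton_iff]
    grind

/-- A chord of a closed strip yields a `K₅`-minor. -/
theorem minor_of_arcs (h : Strip H p q x) (hK4 : H.CliqueFree 4)
    (hinj : Set.InjOn x (Set.Ico 0 n)) (hn : x n = x 0) {s t d e : ℕ} (hs : 3 ≤ s)
    (ht : t + 2 ≤ n) (hsd : s ≤ d) (hdt : d < t) (hse : s ≤ e) (het : e < t)
    (he : e % 2 = 0) (hadj : H.Adj (x 0) (x d)) :
    HasMinor H (⊤ : SimpleGraph (Fin 5)) := by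
  have hdisj := disjoint_image_Ico hinj
  have hp := h.touch_even_hub hK4
  have hq : ∀ a b, q ∉ x '' Set.Ico a b := by
    rintro a b ⟨i, _, hi⟩
    exact h.odd_hub_ne hK4 i hi.symm
  have hins : ∀ a b c d, b ≤ c → d ≤ n →
      Disjoint (x '' Set.Ico a b) (insert q (x '' Set.Ico c d)) := by
    intro a b c d hbc hdn
    rw [Set.disjoint_insert_right]
    exact ⟨hq a b, hdisj a b c d hbc hdn⟩
  obtain ⟨j, hj, hjt, hjn⟩ : ∃ j, j % 2 = 1 ∧ t ≤ j ∧ j < n := by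
    rcases Nat.mod_two_eq_zero_or_one t with ht' | ht'
    · exact ⟨t + 1, by lia, by lia, by lia⟩
    · exact ⟨t, by lia, by lia, by lia⟩
  obtain ⟨k, hk, hkt, hkn⟩ : ∃ k, k % 2 = 0 ∧ t ≤ k ∧ k < n := by
    rcases Nat.mod_two_eq_zero_or_one t with ht' | ht'
    · exact ⟨t, by lia, by lia, by lia⟩
    · exact ⟨t + 1, by lia, by lia, by lia⟩
  obtain ⟨m, rfl⟩ : ∃ m, n = m + 1 := ⟨n - 1, by lia⟩
  obtain ⟨s, rfl⟩ : ∃ s', s = s' + 1 := ⟨s - 1, by lia⟩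
  obtain ⟨t, rfl⟩ : ∃ t', t = t' + 1 := ⟨t - 1, by lia⟩
  have hm : H.Adj (x 0) (x m) := hn ▸ (h.adj_one m).symm
  refine hasMinor_top_five (induce_singleton_connected H p)
    (induce_image_Ico_connected h.adj_one (show 0 < 1 by lia))
    (induce_image_Ico_connected h.adj_one (show 1 < s + 1 by lia))
    (induce_image_Ico_connected h.adj_one (show s + 1 < t + 1 by lia))
    (induce_insert_connected
      (induce_image_Ico_connected h.adj_one (show t + 1 < m + 1 by lia))
      ⟨j, ⟨hjt, hjn⟩, rfl⟩ (h.adj_odd j hj))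
    (hp _ _ 0 rfl (by lia) (by lia)) (hp _ _ 2 rfl (by lia) (by lia))
    (hp _ _ e he (by lia) (by lia)) ⟨?_, ?_⟩
    ⟨hdisj _ _ _ _ (by lia) (by lia), x 0, ⟨0, by simp, rfl⟩, x 1, ⟨1, ⟨by lia, by lia⟩, rfl⟩,
      h.adj_one 0⟩
    ⟨hdisj _ _ _ _ (by lia) (by lia), x 0, ⟨0, by simp, rfl⟩, x d, ⟨d, ⟨by lia, by lia⟩, rfl⟩,
      hadj⟩
    ⟨hins _ _ _ _ (by lia) (by lia), x 0, ⟨0, by simp, rfl⟩, x m,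
      Or.inr ⟨m, ⟨by lia, by lia⟩, rfl⟩, hm⟩
    ⟨hdisj _ _ _ _ (by lia) (by lia), x s, ⟨s, ⟨by lia, by lia⟩, rfl⟩, x (s + 1),
      ⟨s + 1, ⟨by lia, by lia⟩, rfl⟩, h.adj_one s⟩
    ⟨hins _ _ _ _ (by lia) (by lia), x 1, ⟨1, ⟨by lia, by lia⟩, rfl⟩, q, Or.inl rfl,
      (h.adj_odd 1 rfl).symm⟩
    ⟨hins _ _ _ _ (by lia) (by lia), x t, ⟨t, ⟨by lia, by lia⟩, rfl⟩, x (t + 1),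
      Or.inr ⟨t + 1, ⟨by lia, by lia⟩, rfl⟩, h.adj_one t⟩
  · rw [Set.disjoint_insert_right, Set.mem_singleton_iff]
    exact ⟨(h.hub_ne_hub hK4).symm, (hp _ _ k hk hkt hkn).1⟩
  · exact ⟨p, rfl, x k, Or.inr ⟨k, ⟨hkt, hkn⟩, rfl⟩, h.adj_even k hk⟩

theorem minor_of_chord (h : Strip H p q x) (hK4 : H.CliqueFree 4) (hn8 : 8 ≤ n)
    (hinj : Set.InjOn x (Set.Ico 0 n)) (hn : x n = x 0) {d : ℕ}
    (hd : 3 ≤ d) (hdn : d + 3 ≤ n) (hadj : H.Adj (x 0) (x d)) :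
    HasMinor H (⊤ : SimpleGraph (Fin 5)) := by
  rcases Nat.mod_two_eq_zero_or_one d with hd2 | hd2
  · exact h.minor_of_arcs hK4 hinj hn hd (t := d + 1) (by lia) le_rfl (by lia) le_rfl (by lia) hd2
      hadj
  · by_cases hd3 : d = 3
    · exact h.minor_of_arcs hK4 hinj hn hd (t := d + 2) (e := d + 1) (by lia) le_rfl (by lia)
        (by lia) (by lia) (by lia) hadj
    · exact h.minor_of_arcs hK4 hinj hn (s := d - 1) (t := d + 1) (e := d - 1) (by lia) (by lia)
        (by lia) (by lia) (by lia) (by lia) (by lia) hadj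

/-- If all windows of length `n` are injective, a repetition at distance `n` propagates
forwards. -/
theorem eq_succ (h : Strip H p q x) (hK4 : H.CliqueFree 4)
    (hK5 : ¬ HasMinor H (⊤ : SimpleGraph (Fin 5))) (hpos : 0 < n)
    (hgap : ∀ i j, i < j → j < i + n → x i ≠ x j) (hn : x n = x 0) : x (n + 1) = x 1 := by
  have hn8 := h.eight_le hK4 hn hpos
  have heven : n % 2 = 0 := h.mod_two_eq hK4 hn
  have hinj : Set.InjOn x (Set.Ico 0 n) := by
    simpa using injOn_Ico_of_forall_ne hgap 0
  have hwin : ∀ k < n, k ≠ 1 → x (n + 1) ≠ x k := by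
    intro k hk hk1
    rcases Nat.eq_zero_or_pos k with rfl | hk0
    · exact hn ▸ (h.adj_one n).ne'
    · exact (hgap k (n + 1) (by lia) (by lia)).symm
  by_contra hne
  apply hK5
  by_cases hz : x (n + 2) = x 2
  · refine h.minor_of_odd_hub_detour hK4 hn8 hinj hn heven (u := x (n + 1)) (w := x 1) hwin ?_ hne
      (h.even_hub_ne hK4 _).symm (h.even_hub_ne hK4 _).symm (hz ▸ h.adj_one (n + 1)) ?_
      (h.adj_odd _ (by lia)) (h.adj_odd 1 rfl) (h.adj_one 0).symm
    · intro k hk hk1 heq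
      exact hk1 (hinj ⟨by lia, hk⟩ ⟨by lia, by lia⟩ heq.symm)
    · obtain ⟨m, rfl⟩ : ∃ m, n = m + 1 := ⟨n - 1, by lia⟩
      exact (h.adj_two m).symm
  · refine h.minor_of_hub_connection hK4 hn8 hinj hn (Q := {q, x (n + 1), x (n + 2)})
      (induce_insert_connected (SimpleGraph.induce_pair_connected_of_adj (h.adj_one (n + 1)))
        (u := x (n + 1)) (by simp) (h.adj_odd _ (by lia))) (by simp) ?_ ?_
      ⟨x (n + 2), by simp, h.adj_even _ (by lia)⟩
    · simp [h.hub_ne_hub hK4, h.even_hub_ne hK4]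
    · intro k hk
      simp only [Set.mem_insert_iff, Set.mem_singleton_iff, not_or]
      refine ⟨(h.odd_hub_ne hK4 k).symm, ?_, ?_⟩
      · by_cases hk1 : k = 1
        · subst hk1
          exact fun heq => hne heq.symm
        · exact (hwin k hk hk1).symm
      · intro heq
        have hmod := h.mod_two_eq hK4 heq
        obtain rfl | rfl | hk3 : k = 0 ∨ k = 2 ∨ 3 ≤ k := by lia
        · exact hgap n (n + 2) (by lia) (by lia) (hn.trans heq)
        · exact hz heq.symm
        · exact hgap k (n + 2) (by lia) (by lia) heq

/-- If all windows of length `n` are injective, repetitions at distance `n` propagate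
backwards. -/
theorem eq_pred (h : Strip H p q x) (hK4 : H.CliqueFree 4)
    (hK5 : ¬ HasMinor H (⊤ : SimpleGraph (Fin 5))) (hpos : 0 < n)
    (hgap : ∀ i j, i < j → j < i + n → x i ≠ x j) (hn1 : x (n + 1) = x 1)
    (hn2 : x (n + 2) = x 2) : x n = x 0 := by
  have h' : Strip H q p (fun i => x (1 + i)) := h.shift_swap rfl
  have hn : x (1 + n) = x (1 + 0) := by rw [add_comm, hn1]
  have hn8 := h'.eight_le hK4 hn hpos
  have heven : n % 2 = 0 := h'.mod_two_eq hK4 hn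
  have hinj : Set.InjOn (fun i => x (1 + i)) (Set.Ico 0 n) := 
    injOn_Ico_of_forall_ne hgap 1
  by_contra hne
  refine hK5 (h'.minor_of_odd_hub_detour hK4 hn8 hinj hn heven (u := x 2) (w := x 0) ?_ ?_
    (h.adj_two 0).ne' (h.odd_hub_ne hK4 _).symm (h.odd_hub_ne hK4 _).symm (h.adj_one 2) ?_
    (h.adj_even 2 rfl) (h.adj_even 0 rfl) (h.adj_one 0))
  · intro k hk hk1 heq
    exact hk1 (hinj ⟨by lia, hk⟩ ⟨by lia, by lia⟩ heq.symm)
  · intro k hk hk1 heq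
    by_cases hkn : k + 1 = n
    · exact hne (hkn ▸ (add_comm 1 k ▸ heq.symm))
    · exact hgap 0 (1 + k) (by lia) (by lia) heq
  · have heq : 1 + (n - 1) = n := by lia
    simp only [heq]
    exact hn2 ▸ (h.adj_two n).symm

/-- A strip in a finite graph without `K₄` and without `K₅`-minor is periodic, and distinct
within a period. -/
theorem exists_period [Finite W] (h : Strip H p q x) (hK4 : H.CliqueFree 4)
    (hK5 : ¬ HasMinor H (⊤ : SimpleGraph (Fin 5))) :
    ∃ n, 0 < n ∧ (∀ k, x (k + n) = x k) ∧ ∀ i j, i < j → j < i + n → x i ≠ x j := by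
  classical
  have hex : ∃ n, 0 < n ∧ ∃ i, x (i + n) = x i := by
    obtain ⟨i, j, hij, hne⟩ := Finite.exists_ne_map_eq_of_infinite x
    rcases lt_or_gt_of_ne hij with hlt | hlt
    · exact ⟨j - i, by lia, i, by rw [Nat.add_sub_cancel' hlt.le, hne]⟩
    · exact ⟨i - j, by lia, j, by rw [Nat.add_sub_cancel' hlt.le, hne]⟩
  obtain ⟨hpos, i, hi⟩ := Nat.find_spec hex
  have hmin : ∀ d < Nat.find hex, ¬ (0 < d ∧ ∃ i, x (i + d) = x i) :=
    fun d hd => Nat.find_min hex hd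
  generalize Nat.find hex = n at hpos hi hmin
  have hgap : ∀ i j, i < j → j < i + n → x i ≠ x j := by
    intro i j hij hjn heq
    exact hmin (j - i) (by lia) ⟨by lia, i, by rw [Nat.add_sub_cancel' hij.le, heq]⟩
  have hgap' : ∀ k i j, i < j → j < i + n → x (k + i) ≠ x (k + j) := fun k i j hij hjn =>
    hgap _ _ (by lia) (by lia)
  have hsucc : ∀ k, x (k + n) = x k → x (k + 1 + n) = x (k + 1) := by
    intro k hk
    obtain ⟨p', q', h'⟩ := h.exists_shift k
    have := h'.eq_succ hK4 hK5 hpos (hgap' k) hk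
    rwa [add_right_comm, add_assoc]
  have hup : ∀ k, i ≤ k → x (k + n) = x k := by
    intro k hk
    induction k, hk using Nat.le_induction with
    | base => exact hi
    | succ k _ ih => exact hsucc k ih
  have hdown : ∀ d k, i ≤ k + d → x (k + n) = x k := by
    intro d
    induction d with
    | zero => exact hup
    | succ d ih =>
      intro k hk
      obtain ⟨p', q', h'⟩ := h.exists_shift k
      refine h'.eq_pred hK4 hK5 hpos (hgap' k) ?_ ?_
      · have := ih (k + 1) (by lia)
        rwa [add_right_comm, add_assoc] at this
      · have := ih (k + 2) (by lia)
        rwa [add_right_comm, add_assoc] at this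
  exact ⟨n, hpos, fun k => hdown i k (by lia), hgap⟩


theorem adj_iff_of_lt (h : Strip H p q x) (hK4 : H.CliqueFree 4)
    (hK5 : ¬ HasMinor H (⊤ : SimpleGraph (Fin 5))) (hpos : 0 < n)
    (hper : ∀ k, x (k + n) = x k) (hgap : ∀ i j, i < j → j < i + n → x i ≠ x j) {i j : ℕ}
    (hij : i < j) (hjn : j < i + n) : H.Adj (x i) (x j) ↔ j ≤ i + 2 ∨ i + n ≤ j + 2 := by
  have hn8 := h.eight_le hK4 (by simpa using hper 0) hpos
  constructor
  · intro hadj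
    by_contra! hlt
    obtain ⟨p', q', h'⟩ := h.exists_shift i
    have hinj : Set.InjOn (fun k => x (i + k)) (Set.Ico 0 n) := 
    injOn_Ico_of_forall_ne hgap i
    exact hK5 (h'.minor_of_chord hK4 hn8 hinj (hper i) (d := j - i) (by lia) (by lia)
      (by simpa [Nat.add_sub_cancel' hij.le] using hadj))
  · intro hd
    obtain rfl | rfl | hd | hd : j = i + 1 ∨ j = i + 2 ∨ i + n = j + 1 ∨ i + n = j + 2 := by lia
    · exact h.adj_one i
    · exact h.adj_two i
    · rw [← hper i, hd]
      exact (h.adj_one j).symm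
    · rw [← hper i, hd]
      exact (h.adj_two j).symm

theorem adj_iff (h : Strip H p q x) (hK4 : H.CliqueFree 4)
    (hK5 : ¬ HasMinor H (⊤ : SimpleGraph (Fin 5))) (hpos : 0 < n)
    (hper : ∀ k, x (k + n) = x k) (hgap : ∀ i j, i < j → j < i + n → x i ≠ x j) {i j : ℕ}
    (hi : i < n) (hj : j < n) : H.Adj (x i) (x j) ↔
      i ≠ j ∧ (j ≤ i + 2 ∧ i ≤ j + 2 ∨ i + n ≤ j + 2 ∨ j + n ≤ i + 2) := by
  rcases lt_trichotomy i j with hlt | rfl | hlt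
  · rw [h.adj_iff_of_lt hK4 hK5 hpos hper hgap hlt (by lia)]
    lia
  · simp
  · rw [H.adj_comm, h.adj_iff_of_lt hK4 hK5 hpos hper hgap hlt (by lia)]
    lia

theorem not_adj_hubs (h : Strip H p q x) (hK4 : H.CliqueFree 4)
    (hK5 : ¬ HasMinor H (⊤ : SimpleGraph (Fin 5))) (hpos : 0 < n)
    (hper : ∀ k, x (k + n) = x k) (hgap : ∀ i j, i < j → j < i + n → x i ≠ x j) :
    ¬ H.Adj p q := by
  intro hpq
  have hn : x n = x 0 := by simpa using hper 0
  have hinj : Set.InjOn x (Set.Ico 0 n) := by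
    simpa using injOn_Ico_of_forall_ne hgap 0
  exact hK5 (h.minor_of_hub_connection hK4 (h.eight_le hK4 hn hpos) hinj hn (Q := {q})
    (induce_singleton_connected H q) rfl (h.hub_ne_hub hK4)
    (fun k _ => (h.odd_hub_ne hK4 k).symm) ⟨q, rfl, hpq⟩)

end Strip

/-- The vertices of `Ginf` other than the hubs, in the order `a 0, b 0, a 1, b 1, …`. -/
def zigzag (k : ℕ) : Bool ⊕ Bool × ℕ :=
  Sum.inr (decide (k % 2 = 1), k / 2)

theorem zigzag_two_mul_add (c : Bool) (i : ℕ) :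
    zigzag (2 * i + c.toNat) = Sum.inr (c, i) := by
  cases c <;> simp [zigzag]; lia

theorem strip_of_hom {W : Type} {H : SimpleGraph W} (f : Ginf →g H) :
    Strip H (f (Sum.inl false)) (f (Sum.inl true)) (fun k => f (zigzag k)) := by
  refine ⟨fun k => f.map_adj ?_, fun k => f.map_adj ?_, fun k hk => f.map_adj ?_,
    fun k hk => f.map_adj ?_⟩
  · rcases Nat.mod_two_eq_zero_or_one k with hk | hk
    · have hk' : (k + 1) % 2 = 1 := by lia
      simp [Ginf, zigzag, hk, hk']
      lia
    · have hk' : (k + 1) % 2 = 0 := by lia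
      simp [Ginf, zigzag, hk, hk']
      lia
  · rcases Nat.mod_two_eq_zero_or_one k with hk | hk <;> simp [Ginf, zigzag, hk]
  · simp [Ginf, zigzag, hk]
  · simp [Ginf, zigzag, hk]

/-- The map from the vertices of `Dr m` determined by the two hubs and the strip. -/
def stripMap {W : Type} (p q : W) (x : ℕ → W) (m : ℕ) : Bool ⊕ Bool × Fin m → W
  | Sum.inl false => p
  | Sum.inl true => q
  | Sum.inr (c, i) => x (2 * i + c.toNat)

theorem Strip.stripMap_injective {W : Type} {H : SimpleGraph W} {p q : W} {x : ℕ → W} {m : ℕ}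
    (h : Strip H p q x) (hK4 : H.CliqueFree 4)
    (hgap : ∀ i j, i < j → j < i + 2 * m → x i ≠ x j) :
    Function.Injective (stripMap p q x m) := by
  have hp := h.even_hub_ne hK4
  have hq := h.odd_hub_ne hK4
  have hpq := h.hub_ne_hub hK4
  have hinj : Set.InjOn x (Set.Ico 0 (2 * m)) := by
    simpa using injOn_Ico_of_forall_ne hgap 0
  rintro ((_ | _) | ⟨c, i⟩) ((_ | _) | ⟨d, j⟩) heq
  · rfl
  · exact absurd heq hpq
  · exact absurd heq (hp _)
  · exact absurd heq.symm hpq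
  · rfl
  · exact absurd heq (hq _)
  · exact absurd heq.symm (hp _)
  · exact absurd heq.symm (hq _)
  · have hc := c.toNat_le
    have hd := d.toNat_le
    have hcd := hinj ⟨by lia, by lia⟩ ⟨by lia, by lia⟩ heq
    obtain rfl : c = d := by
      cases c <;> cases d <;> simp at hcd ⊢ <;> lia
    obtain rfl : i = j := Fin.ext (by lia)
    rfl

theorem Strip.adj_stripMap_iff {W : Type} {H : SimpleGraph W} {p q : W} {x : ℕ → W} {m : ℕ}
    (h : Strip H p q x) (hK4 : H.CliqueFree 4)
    (hK5 : ¬ HasMinor H (⊤ : SimpleGraph (Fin 5))) (hpos : 0 < 2 * m)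
    (hper : ∀ k, x (k + 2 * m) = x k) (hgap : ∀ i j, i < j → j < i + 2 * m → x i ≠ x j)
    (u v : Bool ⊕ Bool × Fin m) :
    H.Adj (stripMap p q x m u) (stripMap p q x m v) ↔ (Dr m).Adj u v := by
  have hn8 := h.eight_le hK4 (by simpa using hper 0) hpos
  have hpq := h.not_adj_hubs hK4 hK5 hpos hper hgap
  have hp : ∀ (c : Bool) (i : Fin m), H.Adj p (x (2 * i + c.toNat)) ↔ c = false := by
    rintro (_ | _) i
    · simpa using h.adj_even _ (by simp)
    · simpa using h.not_adj_hub_odd hK4 (k := 2 * i + 1) (by lia)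
  have hq : ∀ (c : Bool) (i : Fin m), H.Adj q (x (2 * i + c.toNat)) ↔ c = true := by
    rintro (_ | _) i
    · rw [← hper]
      simpa using h.not_adj_hub_even hK4 (k := 2 * i + 2 * m) (by lia) (by lia)
    · simpa using h.adj_odd _ (by lia)
  rcases u with (_ | _) | ⟨c, i⟩ <;> rcases v with (_ | _) | ⟨d, j⟩
  · simp [Dr]
  · simpa [Dr, stripMap] using hpq
  · simpa [Dr, stripMap, eq_comm] using hp d j
  · simpa [Dr, stripMap, H.adj_comm] using hpq
  · simp [Dr]
  · simpa [Dr, stripMap, eq_comm] using hq d j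
  · simpa [Dr, stripMap, eq_comm, H.adj_comm] using hp c i
  · simpa [Dr, stripMap, eq_comm, H.adj_comm] using hq c i
  · have hc := c.toNat_le
    have hd := d.toNat_le
    have hi := i.isLt
    have hj := j.isLt
    simp only [stripMap]
    rw [h.adj_iff hK4 hK5 hpos hper hgap (by lia) (by lia)]
    cases c <;> cases d <;> simp [Dr, Fin.ext_iff] <;> lia

/-- For every homomorphism `f` from `G∞` into a finite `K₄`-free,
`K₅`-minor-free graph `H`, there are `m ≥ 4` and an embedding `ĝ : D m ↪ H` with
`f = ĝ ∘ δ_{∞,m}`, where `δ_{∞,m}` fixes `v₁, v₂` and reduces indices modulo `m`. -/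
theorem Ginf_hom_factors {W : Type} [Fintype W] (H : SimpleGraph W)
    (hK4 : H.CliqueFree 4) (hK5 : ¬ HasMinor H (⊤ : SimpleGraph (Fin 5)))
    (f : Ginf →g H) :
    ∃ m : ℕ, ∃ _hm : 4 ≤ m, ∃ g : Dr m ↪g H,
      (∀ c : Bool, f (Sum.inl c) = g (Sum.inl c)) ∧
      ∀ (c : Bool) (i : ℕ),
        f (Sum.inr (c, i)) = g (Sum.inr (c, ⟨i % m, Nat.mod_lt _ (by omega)⟩)) := by
  have h := strip_of_hom f
  obtain ⟨n, hpos, hper, hgap⟩ := h.exists_period hK4 hK5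
  have hn : f (zigzag n) = f (zigzag 0) := by simpa using hper 0
  have hn8 := h.eight_le hK4 hn hpos
  obtain ⟨m, rfl⟩ : ∃ m, n = 2 * m := ⟨n / 2, by have := h.mod_two_eq hK4 hn; lia⟩
  refine ⟨m, by lia, ⟨⟨stripMap _ _ _ m, h.stripMap_injective hK4 hgap⟩,
    h.adj_stripMap_iff hK4 hK5 (by lia) hper hgap _ _⟩, ?_, ?_⟩
  · rintro (_ | _) <;> rfl
  · intro c i
    change _ = f (zigzag (2 * (i % m) + c.toNat))
    rw [← zigzag_two_mul_add c i]
    have hmul : ∀ k j, f (zigzag (k + j * (2 * m))) = f (zigzag k) := fun k j =>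
      Function.Periodic.nat_mul (f := fun k => f (zigzag k)) hper j k
    rw [← hmul (2 * (i % m) + c.toNat) (i / m)]
    congr 2
    linarith [Nat.mod_add_div i m]
end
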